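/- Let N ≥ 2, 1 < p < N and 1 ≤ q ≤ p. Then every smooth compactly supported function u : ℝ^N → ℝ satisfies ‖u‖_{p*,q} ≤ S_{N,p} ‖|∇u|‖_{p,q}, where p* := Np/(N−p) is the Sobolev exponent of p and S_{N,p} := ω_N^{−1/N} · p/(N−p), with ω_N the Lebesgue measure of the unit ball of ℝ^N. -/

import Mathlib

open MeasureTheory Set ENNReal

/-- The distribution function `λ_f(k) = |{x ∈ ℝ^N : |f(x)| > k}|` (Lebesgue measure). -/
noncomputable def distribFn {N : ℕ}
    (f : EuclideanSpace ℝ (Fin N) → ℝ) (k : ℝ) : ℝ≥0∞ :=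
  volume {x : EuclideanSpace ℝ (Fin N) | k < |f x|}

/-- The Lorentz quasinorm `‖f‖_{r,q} = (r ∫₀^∞ λ_f(k)^{q/r} k^{q−1} dk)^{1/q}`. -/
noncomputable def lorentzNorm {N : ℕ}
    (r q : ℝ) (f : EuclideanSpace ℝ (Fin N) → ℝ) : ℝ≥0∞ :=
  (ENNReal.ofReal r *
    ∫⁻ k in Ioi (0 : ℝ), distribFn f k ^ (q / r) * ENNReal.ofReal (k ^ (q - 1))) ^ (1 / q)

section Pointwise

open scoped Pointwise

theorem Real.volume_add_volume_le_of_isCompact {A B : Set ℝ} (hA : IsCompact A) (hB : IsCompact B)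
    (hA' : A.Nonempty) (hB' : B.Nonempty) : volume A + volume B ≤ volume (A + B) := by
  obtain ⟨a, ha, hamax⟩ := hA.exists_isGreatest hA'
  obtain ⟨b, hb, hbmin⟩ := hB.exists_isLeast hB'
  have h1 : volume ((fun x => x + b) '' A) = volume A := by simp
  have h2 : volume ((fun x => a + x) '' B) = volume B := by simp
  have hm : MeasurableSet ((fun x => a + x) '' B) :=
    (hB.image (by fun_prop)).measurableSet
  rw [← h1, ← h2, ← measure_union₀ hm.nullMeasurableSet]
  · apply measure_mono
    rintro _ (⟨x, hx, rfl⟩ | ⟨x, hx, rfl⟩)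
    · exact add_mem_add hx hb
    · exact add_mem_add ha hx
  · refine measure_mono_null (t := {a + b}) ?_ (by simp)
    rintro _ ⟨⟨x, hx, rfl⟩, ⟨y, hy, hxy⟩⟩
    have := hamax hx
    have := hbmin hy
    simp only at hxy
    simp only [mem_singleton_iff]
    linarith

/-- The one-dimensional Brunn–Minkowski inequality. -/
theorem Real.volume_add_volume_le {A B : Set ℝ} (hA : MeasurableSet A) (hB : MeasurableSet B)
    (hA' : A.Nonempty) (hB' : B.Nonempty) : volume A + volume B ≤ volume (A + B) := by
  obtain ⟨a, ha⟩ := hA'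
  obtain ⟨b, hb⟩ := hB'
  rw [hA.measure_eq_iSup_isCompact, hB.measure_eq_iSup_isCompact]
  simp only [iSup_and']
  refine ENNReal.biSup_add_biSup_le' ⟨∅, by simp⟩ ⟨∅, by simp⟩ ?_
  rintro K ⟨hKA, hK⟩ L ⟨hLB, hL⟩
  calc volume K + volume L ≤ volume (insert a K) + volume (insert b L) := by
        gcongr <;> exact subset_insert _ _
    _ ≤ volume (insert a K + insert b L) :=
        volume_add_volume_le_of_isCompact (hK.insert a) (hL.insert b) (insert_nonempty _ _)
          (insert_nonempty _ _)
    _ ≤ _ := by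
        gcongr
        · exact insert_subset ha hKA
        · exact insert_subset hb hLB

theorem ENNReal.geom_mean_le_arith_mean2_weighted {s t : ℝ} (hs : 0 < s) (ht : 0 < t)
    (hst : s + t = 1) (a b : ℝ≥0∞) :
    a ^ s * b ^ t ≤ ENNReal.ofReal s * a + ENNReal.ofReal t * b := by
  have hpq : (1 / s).HolderConjugate (1 / t) := by
    rw [Real.holderConjugate_iff]
    constructor
    · rw [lt_div_iff₀ hs]; linarith
    · simpa using hst
  have := ENNReal.young_inequality (a ^ s) (b ^ t) hpq
  rw [← ENNReal.rpow_mul, ← ENNReal.rpow_mul, mul_one_div_cancel hs.ne',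
    mul_one_div_cancel ht.ne', ENNReal.rpow_one, ENNReal.rpow_one] at this
  refine this.trans (le_of_eq ?_)
  simp only [div_eq_mul_inv, one_mul]
  rw [ENNReal.ofReal_inv_of_pos hs,
    ENNReal.ofReal_inv_of_pos ht, inv_inv, inv_inv, mul_comm, mul_comm b]

/-- A one-dimensional Prékopa–Leindler inequality in arithmetic form, for functions
with supremum one. -/
theorem prekopaLeindler_arith {s t : ℝ} (hs : 0 < s) (ht : 0 < t) (hst : s + t = 1)
    {f g h : ℝ → ℝ≥0∞} (hf : Measurable f) (hg : Measurable g) (hh : Measurable h)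
    (hf1 : ⨆ x, f x = 1) (hg1 : ⨆ x, g x = 1)
    (H : ∀ x y, f x ^ s * g y ^ t ≤ h (s * x + t * y)) :
    ENNReal.ofReal s * (∫⁻ x, f x) + ENNReal.ofReal t * (∫⁻ x, g x) ≤ ∫⁻ x, h x := by
  have key : ∀ {f : ℝ → ℝ≥0∞}, Measurable f → (∀ x, f x ≤ 1) →
      ∫⁻ x, f x = ∫⁻ k in Ioi (0 : ℝ), volume {x | ENNReal.ofReal k < f x} := by
    intro f hf hf1
    have : ∫⁻ x, f x = ∫⁻ x, ENNReal.ofReal (f x).toReal := by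
      refine lintegral_congr fun x => ?_
      rw [ENNReal.ofReal_toReal ((hf1 x).trans_lt one_lt_top).ne]
    rw [this, lintegral_eq_lintegral_meas_lt _ (ae_of_all _ fun _ => toReal_nonneg)
      hf.ennreal_toReal.aemeasurable]
    refine setLIntegral_congr_fun measurableSet_Ioi fun k hk => ?_
    congr 1 with x
    exact (ENNReal.ofReal_lt_iff_lt_toReal (le_of_lt hk) ((hf1 x).trans_lt one_lt_top).ne).symm
  have hfle : ∀ x, f x ≤ 1 := fun x => hf1 ▸ le_iSup f x
  have hgle : ∀ x, g x ≤ 1 := fun x => hg1 ▸ le_iSup g x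
  have hmeas : ∀ f : ℝ → ℝ≥0∞, Measurable fun k : ℝ => volume {x | ENNReal.ofReal k < f x} :=
    fun f => Antitone.measurable fun a b hab => measure_mono fun x hx =>
      lt_of_le_of_lt (ENNReal.ofReal_le_ofReal hab) hx
  calc ENNReal.ofReal s * (∫⁻ x, f x) + ENNReal.ofReal t * (∫⁻ x, g x)
      = ∫⁻ k in Ioi (0 : ℝ), (ENNReal.ofReal s * volume {x | ENNReal.ofReal k < f x}
          + ENNReal.ofReal t * volume {x | ENNReal.ofReal k < g x}) := by
        rw [key hf hfle, key hg hgle, lintegral_add_left ((hmeas f).const_mul _),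
          lintegral_const_mul _ (hmeas f), lintegral_const_mul _ (hmeas g)]
    _ ≤ ∫⁻ k in Ioi (0 : ℝ), volume {x | ENNReal.ofReal k < min (h x) 1} := by
        refine setLIntegral_mono' measurableSet_Ioi fun k (hk : 0 < k) => ?_
        rcases lt_or_ge k 1 with hk1 | hk1
        · have hk1' : ENNReal.ofReal k < 1 := by simpa using hk1
          have hfn : {x | ENNReal.ofReal k < f x}.Nonempty := by
            rw [← hf1] at hk1'
            exact lt_iSup_iff.1 hk1'
          have hgn : {x | ENNReal.ofReal k < g x}.Nonempty := by
            rw [← hg1] at hk1'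
            exact lt_iSup_iff.1 hk1'
          have hfm : MeasurableSet {x | ENNReal.ofReal k < f x} :=
            measurableSet_lt measurable_const hf
          have hgm : MeasurableSet {x | ENNReal.ofReal k < g x} :=
            measurableSet_lt measurable_const hg
          have h1 := Real.volume_add_volume_le (hfm.const_smul₀ s) (hgm.const_smul₀ t)
            (hfn.smul_set (a := s)) (hgn.smul_set (a := t))
          rw [Measure.addHaar_smul, Measure.addHaar_smul] at h1
          simp only [Module.finrank_self, pow_one, abs_of_pos hs, abs_of_pos ht] at h1
          refine h1.trans (measure_mono ?_)
          rintro _ ⟨_, ⟨x, hx, rfl⟩, _, ⟨y, hy, rfl⟩, rfl⟩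
          simp only [smul_eq_mul, mem_ofPred_eq, lt_min_iff] at hx hy ⊢
          refine ⟨lt_of_lt_of_le ?_ (H x y), hk1'⟩
          have hk0 : ENNReal.ofReal k ≠ 0 := by simpa using hk
          calc ENNReal.ofReal k = ENNReal.ofReal k ^ s * ENNReal.ofReal k ^ t := by
                rw [← ENNReal.rpow_add _ _ hk0 ofReal_ne_top, hst, ENNReal.rpow_one]
            _ < _ := ENNReal.mul_lt_mul (ENNReal.rpow_lt_rpow hx hs) (ENNReal.rpow_lt_rpow hy ht)
        · have hk1' : 1 ≤ ENNReal.ofReal k := by simpa using hk1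
          have h1 : ∀ f : ℝ → ℝ≥0∞, (∀ x, f x ≤ 1) → {x | ENNReal.ofReal k < f x} = ∅ := by
            intro f hf
            ext x
            simpa using (hf x).trans hk1'
          simp [h1 f hfle, h1 g hgle]
    _ = ∫⁻ x, min (h x) 1 := (key (hh.min measurable_const) fun x => min_le_right _ _).symm
    _ ≤ ∫⁻ x, h x := lintegral_mono fun x => min_le_left _ _

theorem prekopaLeindler_real_of_bounded {s t : ℝ} (hs : 0 < s) (ht : 0 < t) (hst : s + t = 1)
    {f g h : ℝ → ℝ≥0∞} (hf : Measurable f) (hg : Measurable g) (hh : Measurable h)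
    (hf1 : ⨆ x, f x ≠ ⊤) (hg1 : ⨆ x, g x ≠ ⊤)
    (H : ∀ x y, f x ^ s * g y ^ t ≤ h (s * x + t * y)) :
    (∫⁻ x, f x) ^ s * (∫⁻ x, g x) ^ t ≤ ∫⁻ x, h x := by
  rcases eq_or_ne (⨆ x, f x) 0 with hf0 | hf0
  · have : ∀ x, f x = 0 := by simpa using hf0
    simp [this, hs]
  rcases eq_or_ne (⨆ x, g x) 0 with hg0 | hg0
  · have : ∀ x, g x = 0 := by simpa using hg0
    simp [this, ht]
  set a := ⨆ x, f x
  set b := ⨆ x, g x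
  set c := a ^ s * b ^ t with hc
  have hc0 : c ≠ 0 := by
    simp [hc, hs.not_gt, ht.not_gt, hf0, hg0, hf1, hg1]
  have hct : c ≠ ⊤ :=
    mul_ne_top (rpow_ne_top_of_nonneg hs.le hf1) (rpow_ne_top_of_nonneg ht.le hg1)
  have h1 := prekopaLeindler_arith hs ht hst (f := fun x => a⁻¹ * f x) (g := fun x => b⁻¹ * g x)
    (h := fun x => c⁻¹ * h x) (hf.const_mul _) (hg.const_mul _) (hh.const_mul _)
    (by rw [← mul_iSup, ENNReal.inv_mul_cancel hf0 hf1])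
    (by rw [← mul_iSup, ENNReal.inv_mul_cancel hg0 hg1])
    (fun x y => by
      rw [ENNReal.mul_rpow_of_nonneg _ _ hs.le, ENNReal.mul_rpow_of_nonneg _ _ ht.le,
        mul_mul_mul_comm, ENNReal.inv_rpow, ENNReal.inv_rpow,
        ← ENNReal.mul_inv (Or.inr (rpow_ne_top_of_nonneg ht.le hg1))
          (Or.inl (rpow_ne_top_of_nonneg hs.le hf1))]
      gcongr
      exact H x y)
  have h2 := (ENNReal.geom_mean_le_arith_mean2_weighted hs ht hst _ _).trans h1
  rw [lintegral_const_mul _ hf, lintegral_const_mul _ hg, lintegral_const_mul _ hh,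
    ENNReal.mul_rpow_of_nonneg _ _ hs.le, ENNReal.mul_rpow_of_nonneg _ _ ht.le,
    mul_mul_mul_comm, ENNReal.inv_rpow, ENNReal.inv_rpow,
    ← ENNReal.mul_inv (Or.inr (rpow_ne_top_of_nonneg ht.le hg1))
      (Or.inl (rpow_ne_top_of_nonneg hs.le hf1))] at h2
  exact (ENNReal.mul_le_mul_iff_right (ENNReal.inv_ne_zero.2 hct) (ENNReal.inv_ne_top.2 hc0)).1 h2

/-- The one-dimensional Prékopa–Leindler inequality. -/
theorem prekopaLeindler_real {s t : ℝ} (hs : 0 < s) (ht : 0 < t) (hst : s + t = 1)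
    {f g h : ℝ → ℝ≥0∞} (hf : Measurable f) (hg : Measurable g) (hh : Measurable h)
    (H : ∀ x y, f x ^ s * g y ^ t ≤ h (s * x + t * y)) :
    (∫⁻ x, f x) ^ s * (∫⁻ x, g x) ^ t ≤ ∫⁻ x, h x := by
  have key : ∀ {f : ℝ → ℝ≥0∞}, Measurable f →
      Filter.Tendsto (fun n : ℕ => ∫⁻ x, min (f x) n) Filter.atTop (nhds (∫⁻ x, f x)) := by
    intro f hf
    refine lintegral_tendsto_of_tendsto_of_monotone
      (fun n => (hf.min measurable_const).aemeasurable) (ae_of_all _ fun x m n hmn => ?_)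
      (ae_of_all _ fun x => ?_)
    · exact min_le_min le_rfl (by exact_mod_cast hmn)
    · have := (tendsto_const_nhds (x := f x)).min ENNReal.tendsto_nat_nhds_top
      simpa using this
  have hb : ∀ (f : ℝ → ℝ≥0∞) (n : ℕ), ⨆ x, min (f x) n ≠ ⊤ := fun f n =>
    ((iSup_le fun x => min_le_right _ _).trans_lt (natCast_lt_top n)).ne
  have h1 : ∀ n : ℕ, (∫⁻ x, min (f x) n) ^ s * (∫⁻ x, min (g x) n) ^ t ≤ ∫⁻ x, h x := fun n =>
    prekopaLeindler_real_of_bounded hs ht hst (hf.min measurable_const) (hg.min measurable_const)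
      hh (hb f n) (hb g n) fun x y => (mul_le_mul'
        (rpow_le_rpow (min_le_left _ _) hs.le) (rpow_le_rpow (min_le_left _ _) ht.le)).trans (H x y)
  rcases eq_or_ne (∫⁻ x, f x) 0 with hf0 | hf0
  · simp [hf0, hs]
  rcases eq_or_ne (∫⁻ x, g x) 0 with hg0 | hg0
  · simp [hg0, ht]
  refine le_of_tendsto' (ENNReal.Tendsto.mul ((ENNReal.continuous_rpow_const).continuousAt.tendsto.comp (key hf))
    (Or.inl ?_) ((ENNReal.continuous_rpow_const).continuousAt.tendsto.comp (key hg)) (Or.inl ?_)) h1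
  · simp [hf0, hs.not_gt]
  · simp [hg0, ht.not_gt]

/-- The Prékopa–Leindler inequality. -/
theorem prekopaLeindler_pi {s t : ℝ} (hs : 0 < s) (ht : 0 < t) (hst : s + t = 1) (n : ℕ)
    {f g h : (Fin n → ℝ) → ℝ≥0∞} (hf : Measurable f) (hg : Measurable g) (hh : Measurable h)
    (H : ∀ x y, f x ^ s * g y ^ t ≤ h (s • x + t • y)) :
    (∫⁻ x, f x) ^ s * (∫⁻ x, g x) ^ t ≤ ∫⁻ x, h x := by
  induction n with
  | zero =>
    have hu : (volume : Measure (Fin 0 → ℝ)) univ = 1 := by simp [volume_pi]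
    have key : ∀ f : (Fin 0 → ℝ) → ℝ≥0∞, ∫⁻ x, f x = f 0 := by
      intro f
      have : f = fun _ => f 0 := by
        ext x
        rw [Subsingleton.elim x 0]
      rw [this, lintegral_const, hu, mul_one]
    rw [key, key, key]
    simpa using H 0 0
  | succ n ih =>
    let e := (MeasurableEquiv.piFinSuccAbove (fun _ : Fin (n + 1) => ℝ) 0)
    have he : MeasurePreserving e.symm :=
      (volume_preserving_piFinSuccAbove (fun _ : Fin (n + 1) => ℝ) 0).symm
    have key : ∀ {f : (Fin (n + 1) → ℝ) → ℝ≥0∞}, Measurable f →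
        ∫⁻ x, f x = ∫⁻ a : ℝ, ∫⁻ y : Fin n → ℝ, f (e.symm (a, y)) := by
      intro f hf
      rw [← he.lintegral_comp hf]
      exact lintegral_prod _ (hf.comp e.symm.measurable).aemeasurable
    have hm : ∀ {f : (Fin (n + 1) → ℝ) → ℝ≥0∞}, Measurable f →
        Measurable fun a : ℝ => ∫⁻ y : Fin n → ℝ, f (e.symm (a, y)) := fun hf =>
      (hf.comp e.symm.measurable).lintegral_prod_right'
    rw [key hf, key hg, key hh]
    refine prekopaLeindler_real hs ht hst (hm hf) (hm hg) (hm hh) fun a b => ?_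
    refine ih (hf.comp (e.symm.measurable.comp measurable_prodMk_left))
      (hg.comp (e.symm.measurable.comp measurable_prodMk_left))
      (hh.comp (e.symm.measurable.comp measurable_prodMk_left)) fun x y => ?_
    refine (H _ _).trans (le_of_eq ?_)
    congr 1
    ext i
    refine Fin.cases ?_ (fun i => ?_) i <;> simp [e, MeasurableEquiv.piFinSuccAbove]

/-- The Brunn–Minkowski inequality in multiplicative form. -/
theorem EuclideanSpace.volume_rpow_mul_volume_rpow_le {N : ℕ} {s t : ℝ} (hs : 0 < s) (ht : 0 < t)
    (hst : s + t = 1) {A B C : Set (EuclideanSpace ℝ (Fin N))} (hA : MeasurableSet A)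
    (hB : MeasurableSet B) (hC : MeasurableSet C)
    (H : ∀ x ∈ A, ∀ y ∈ B, s • x + t • y ∈ C) :
    volume A ^ s * volume B ^ t ≤ volume C := by
  have hp := PiLp.volume_preserving_toLp (Fin N)
  have key : ∀ {S : Set (EuclideanSpace ℝ (Fin N))}, MeasurableSet S →
      volume S = ∫⁻ x : Fin N → ℝ, (WithLp.toLp 2 ⁻¹' S).indicator 1 x := by
    intro S hS
    rw [lintegral_indicator_one (hp.measurable hS), hp.measure_preimage hS.nullMeasurableSet]
  rw [key hA, key hB, key hC]
  refine prekopaLeindler_pi hs ht hst N (measurable_one.indicator (hp.measurable hA))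
    (measurable_one.indicator (hp.measurable hB)) (measurable_one.indicator (hp.measurable hC))
    fun x y => ?_
  by_cases hx : WithLp.toLp 2 x ∈ A
  · by_cases hy : WithLp.toLp 2 y ∈ B
    · have : s • x + t • y ∈ WithLp.toLp 2 ⁻¹' C := H _ hx _ hy
      simp [indicator, hx, hy, this]
    · simp [indicator, hy, ht]
  · simp [indicator, hx, hs]

/-- The isoperimetric inequality, in quantitative form for open neighbourhoods. -/
theorem EuclideanSpace.volume_add_le_volume_thickening {N : ℕ} (hN : 2 ≤ N)
    {A : Set (EuclideanSpace ℝ (Fin N))} (hA : MeasurableSet A) (hAt : volume A ≠ ⊤)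
    {ε : ℝ} (hε : 0 < ε) :
    volume A + ENNReal.ofReal ε * (N * volume (Metric.ball (0 : EuclideanSpace ℝ (Fin N)) 1) ^
      (1 / (N : ℝ)) * volume A ^ (1 - 1 / (N : ℝ))) ≤ volume (Metric.thickening ε A) := by
  have hN0 : (N : ℝ) ≠ 0 := by positivity
  have hN1 : 0 < 1 - 1 / (N : ℝ) := by
    rw [sub_pos, div_lt_one (by positivity)]
    exact_mod_cast hN
  have : Nonempty (Fin N) := ⟨⟨0, by lia⟩⟩
  rcases eq_or_ne (volume A) 0 with h0 | h0
  · rw [h0, ENNReal.zero_rpow_of_pos hN1]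
    simp
  set ω := (volume (Metric.ball (0 : EuclideanSpace ℝ (Fin N)) 1)).toReal with hω
  have hωt : volume (Metric.ball (0 : EuclideanSpace ℝ (Fin N)) 1) ≠ ⊤ := measure_ball_lt_top.ne
  have hω0 : 0 < ω := toReal_pos (Metric.measure_ball_pos _ _ one_pos).ne' hωt
  set m := (volume A).toReal with hm
  have hm0 : 0 < m := toReal_pos h0 hAt
  have hmA : volume A = ENNReal.ofReal m := (ofReal_toReal hAt).symm
  have hωB : volume (Metric.ball (0 : EuclideanSpace ℝ (Fin N)) 1) = ENNReal.ofReal ω :=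
    (ofReal_toReal hωt).symm
  set a := m ^ (1 / (N : ℝ)) with ha
  set w := ω ^ (1 / (N : ℝ)) with hw
  have ha0 : 0 < a := by positivity
  have hw0 : 0 < w := by positivity
  have haN : a ^ N = m := by
    rw [ha, ← Real.rpow_natCast, ← Real.rpow_mul hm0.le, one_div_mul_cancel hN0, Real.rpow_one]
  have hwN : w ^ N = ω := by
    rw [hw, ← Real.rpow_natCast, ← Real.rpow_mul hω0.le, one_div_mul_cancel hN0, Real.rpow_one]
  have ham : m ^ (1 - 1 / (N : ℝ)) = a ^ (N - 1) := by
    rw [ha, ← Real.rpow_natCast, ← Real.rpow_mul hm0.le, Nat.cast_sub (by lia)]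
    congr 1
    field_simp
    simp
  set c := a + ε * w with hc
  have hc0 : 0 < c := by positivity
  set s := a / c with hs
  set t := ε * w / c with ht
  have hs0 : 0 < s := by positivity
  have ht0 : 0 < t := by positivity
  have hst : s + t = 1 := by rw [hs, ht, ← add_div, div_self hc0.ne']
  have h1 := EuclideanSpace.volume_rpow_mul_volume_rpow_le hs0 ht0 hst (hA.const_smul₀ s⁻¹)
    ((Metric.isOpen_ball (x := (0 : EuclideanSpace ℝ (Fin N))) (ε := ε)).measurableSet.const_smul₀
      t⁻¹) (Metric.isOpen_thickening (δ := ε) (E := A)).measurableSet (by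
    rintro _ ⟨x, hx, rfl⟩ _ ⟨y, hy, rfl⟩
    simp only [smul_smul, mul_inv_cancel₀ hs0.ne', mul_inv_cancel₀ ht0.ne', one_smul]
    rw [Metric.mem_thickening_iff]
    exact ⟨x, hx, by simpa using hy⟩)
  have hvA : volume (s⁻¹ • A) = ENNReal.ofReal (c ^ N) := by
    rw [Measure.addHaar_smul, hmA, ← ENNReal.ofReal_mul (by positivity)]
    congr 1
    rw [finrank_euclideanSpace_fin, abs_of_pos (by positivity), ← haN, ← mul_pow, hs]
    congr 1
    field_simp
  have hvB : volume (t⁻¹ • Metric.ball (0 : EuclideanSpace ℝ (Fin N)) ε) =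
      ENNReal.ofReal (c ^ N) := by
    rw [Measure.addHaar_smul, Measure.addHaar_ball _ _ hε.le, hωB,
      ← ENNReal.ofReal_mul (by positivity), ← ENNReal.ofReal_mul (by positivity)]
    congr 1
    rw [finrank_euclideanSpace_fin, abs_of_pos (by positivity), ← hwN, ← mul_pow, ← mul_pow, ht]
    congr 1
    field_simp
  rw [hvA, hvB, ← ENNReal.rpow_add _ _ (by simpa using pow_pos hc0 N) ofReal_ne_top, hst,
    ENNReal.rpow_one] at h1
  refine le_trans ?_ h1
  rw [hmA, hωB, ENNReal.ofReal_rpow_of_pos hω0, ENNReal.ofReal_rpow_of_pos hm0, ham, ← hw,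
    ← ENNReal.ofReal_natCast, ← ENNReal.ofReal_mul (by positivity),
    ← ENNReal.ofReal_mul (by positivity), ← ENNReal.ofReal_mul (by positivity),
    ← ENNReal.ofReal_add (by positivity) (by positivity)]
  refine ENNReal.ofReal_le_ofReal ?_
  have h2 := pow_add_mul_le_add_pow ha0.le (b := ε * w) (by positivity) N
  rw [haN] at h2
  refine le_trans (le_of_eq ?_) h2
  ring

section Coarea

open Filter Topology

variable {N : ℕ} {u : EuclideanSpace ℝ (Fin N) → ℝ}

/-- The measure of the set of levels in `F` separating the value `|u x|` from some value of `|u|` on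
the ball of radius `ε` around `x`. -/
noncomputable def levelOscillation (u : EuclideanSpace ℝ (Fin N) → ℝ) (F : Set ℝ) (ε : ℝ)
    (x : EuclideanSpace ℝ (Fin N)) : ℝ≥0∞ :=
  volume {t | t ∈ F ∧ |u x| ≤ t ∧ x ∈ Metric.thickening ε {y | t < |u y|}}

theorem measurableSet_levelOscillation (hu : Continuous u) {F : Set ℝ} (hF : MeasurableSet F)
    (ε : ℝ) : MeasurableSet {z : EuclideanSpace ℝ (Fin N) × ℝ |
      z.2 ∈ F ∧ |u z.1| ≤ z.2 ∧ z.1 ∈ Metric.thickening ε {y | z.2 < |u y|}} := by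
  refine (measurable_snd hF).inter (MeasurableSet.inter ?_ (IsOpen.measurableSet ?_))
  · exact measurableSet_le (hu.comp continuous_fst).abs.measurable measurable_snd
  · have : {z : EuclideanSpace ℝ (Fin N) × ℝ | z.1 ∈ Metric.thickening ε {y | z.2 < |u y|}} =
        ⋃ y, {z | dist z.1 y < ε ∧ z.2 < |u y|} := by
      ext z
      simp [Metric.mem_thickening_iff, and_comm]
    change IsOpen {z : EuclideanSpace ℝ (Fin N) × ℝ | z.1 ∈ Metric.thickening ε {y | z.2 < |u y|}}
    rw [this]
    refine isOpen_iUnion fun y => IsOpen.inter ?_ ?_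
    · exact isOpen_lt (continuous_fst.dist continuous_const) continuous_const
    · exact isOpen_lt continuous_snd continuous_const

theorem measurable_levelOscillation (hu : Continuous u) {F : Set ℝ} (hF : MeasurableSet F)
    (ε : ℝ) : Measurable (levelOscillation u F ε) :=
  measurable_measure_prodMk_left (measurableSet_levelOscillation hu hF ε)

theorem levelOscillation_le {F : Set ℝ} {ε r : ℝ} {x : EuclideanSpace ℝ (Fin N)}
    (h : ∀ y, dist x y < ε → |u y| ≤ |u x| + r) : levelOscillation u F ε x ≤ ENNReal.ofReal r := by
  calc levelOscillation u F ε x ≤ volume (Ico |u x| (|u x| + r)) := by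
        refine measure_mono fun t ht => ⟨ht.2.1, ?_⟩
        obtain ⟨y, hy, hxy⟩ := Metric.mem_thickening_iff.1 ht.2.2
        exact lt_of_lt_of_le hy (h y hxy)
    _ = ENNReal.ofReal r := by simp

theorem lintegral_levelOscillation_ge (hN : 2 ≤ N) (hu : Continuous u) (hc : HasCompactSupport u)
    {F : Set ℝ} (hF : MeasurableSet F) (hF0 : F ⊆ Ioi 0) {ε : ℝ} (hε : 0 < ε) :
    ENNReal.ofReal ε * ∫⁻ t in F, N * volume (Metric.ball (0 : EuclideanSpace ℝ (Fin N)) 1) ^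
      (1 / (N : ℝ)) * distribFn u t ^ (1 - 1 / (N : ℝ)) ≤ ∫⁻ x, levelOscillation u F ε x := by
  have hS := measurableSet_levelOscillation hu hF ε
  have h1 : ∫⁻ x, levelOscillation u F ε x = ∫⁻ t, volume {x | t ∈ F ∧ |u x| ≤ t ∧
      x ∈ Metric.thickening ε {y | t < |u y|}} := by
    have := (Measure.prod_apply (μ := volume) (ν := volume) hS).symm.trans
      (Measure.prod_apply_symm hS)
    exact this
  rw [h1, ← lintegral_const_mul' _ _ ofReal_ne_top, ← lintegral_indicator hF]
  refine lintegral_mono fun t => ?_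
  by_cases ht : t ∈ F
  · simp only [ht, indicator_of_mem, true_and]
    have hAm : MeasurableSet {x | t < |u x|} := measurableSet_lt measurable_const hu.abs.measurable
    have hAt : volume {x | t < |u x|} ≠ ⊤ := by
      refine ((measure_mono fun x hx => ?_).trans_lt hc.measure_lt_top).ne
      refine subset_tsupport u ?_
      rintro h0
      have : 0 < t := hF0 ht
      simp only [mem_ofPred_eq, h0, abs_zero] at hx
      linarith
    have h2 := EuclideanSpace.volume_add_le_volume_thickening hN hAm hAt hε
    refine (ENNReal.add_le_add_iff_left hAt).1 (h2.trans ?_)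
    refine (measure_mono fun x hx => ?_).trans (measure_union_le _ _)
    rcases lt_or_ge t |u x| with h | h
    · exact Or.inl h
    · exact Or.inr ⟨h, hx⟩
  · simp [ht]

theorem limsup_levelOscillation_le (hu : ContDiff ℝ 1 u) {F : Set ℝ} (hF : IsClosed F)
    {ε : ℕ → ℝ} (hε0 : ∀ n, 0 < ε n) (hε : Tendsto ε atTop (𝓝 0)) (x : EuclideanSpace ℝ (Fin N)) :
    limsup (fun n => (ENNReal.ofReal (ε n))⁻¹ * levelOscillation u F (ε n) x) atTop ≤
      {x | |u x| ∈ F}.indicator (fun x => ‖fderiv ℝ u x‖ₑ) x := by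
  by_cases hx : |u x| ∈ F
  · have hx' : x ∈ {x | |u x| ∈ F} := hx
    rw [indicator_of_mem hx']
    refine ENNReal.le_of_forall_pos_le_add fun η hη _ => ?_
    refine limsup_le_of_le (h := ?_)
    have hd : HasFDerivAt u (fderiv ℝ u x) x :=
      (hu.differentiable one_ne_zero x).hasFDerivAt
    have h1 := hd.isLittleO.bound (c := η) (by exact_mod_cast hη)
    obtain ⟨δ, hδ, h2⟩ := Metric.eventually_nhds_iff.1 h1
    filter_upwards [hε.eventually_lt_const hδ] with n hn
    have h3 : levelOscillation u F (ε n) x ≤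
        ENNReal.ofReal ((‖fderiv ℝ u x‖ + η) * ε n) := by
      refine levelOscillation_le fun y hy => ?_
      have h4 := h2 (y := y) (by rw [dist_comm]; exact hy.trans hn)
      have h5 := (fderiv ℝ u x).le_opNorm (y - x)
      have h6 : ‖y - x‖ ≤ ε n := by rw [← dist_eq_norm, dist_comm]; exact hy.le
      have h7 : ‖u y - u x‖ ≤ (‖fderiv ℝ u x‖ + η) * ‖y - x‖ := by
        calc ‖u y - u x‖ = ‖(u y - u x - fderiv ℝ u x (y - x)) + fderiv ℝ u x (y - x)‖ := by
              rw [sub_add_cancel]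
          _ ≤ _ := (norm_add_le _ _).trans (by linarith)
      have h8 : |u y| - |u x| ≤ ‖u y - u x‖ := abs_sub_abs_le_abs_sub _ _
      have h9 : (‖fderiv ℝ u x‖ + η) * ‖y - x‖ ≤ (‖fderiv ℝ u x‖ + η) * ε n := by gcongr
      linarith
    have h0 : ENNReal.ofReal (ε n) ≠ 0 := by simpa using hε0 n
    calc (ENNReal.ofReal (ε n))⁻¹ * levelOscillation u F (ε n) x
        ≤ (ENNReal.ofReal (ε n))⁻¹ * ENNReal.ofReal ((‖fderiv ℝ u x‖ + η) * ε n) := by gcongr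
      _ = ‖fderiv ℝ u x‖ₑ + η := by
        rw [ENNReal.ofReal_mul (by positivity), mul_comm, mul_assoc,
          ENNReal.mul_inv_cancel h0 ofReal_ne_top, mul_one,
          ENNReal.ofReal_add (by positivity) (by positivity), ofReal_norm, ofReal_coe_nnreal]
  · have hx' : x ∉ {x | |u x| ∈ F} := hx
    rw [indicator_of_notMem hx']
    refine limsup_le_of_le (h := ?_)
    obtain ⟨r, hr, h1⟩ := Metric.isOpen_iff.1 hF.isOpen_compl _ hx
    obtain ⟨δ, hδ, h2⟩ := Metric.continuousAt_iff.1 (hu.continuous.continuousAt (x := x)) r hr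
    filter_upwards [hε.eventually_lt_const hδ] with n hn
    have : {t | t ∈ F ∧ |u x| ≤ t ∧ x ∈ Metric.thickening (ε n) {y | t < |u y|}} = ∅ := by
      refine eq_empty_of_forall_notMem fun t ⟨ht, hxt, hxA⟩ => ?_
      obtain ⟨y, hy, hxy⟩ := Metric.mem_thickening_iff.1 hxA
      have ht' : t ∉ Metric.ball |u x| r := fun h => h1 h ht
      refine ht' ?_
      have h3 := h2 (x := y) (by rw [dist_comm]; exact hxy.trans hn)
      have h8 : |u y| - |u x| ≤ |u y - u x| := abs_sub_abs_le_abs_sub _ _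
      rw [Real.dist_eq] at h3
      have hy' : t < |u y| := hy
      rw [Metric.mem_ball, Real.dist_eq, abs_of_nonneg (by linarith)]
      linarith
    simp [levelOscillation, this]

theorem lintegral_isoperimetric_le_of_isClosed (hN : 2 ≤ N) (hu : ContDiff ℝ 1 u)
    (hc : HasCompactSupport u) {F : Set ℝ} (hF : IsClosed F) (hF0 : F ⊆ Ioi 0) :
    ∫⁻ t in F, N * volume (Metric.ball (0 : EuclideanSpace ℝ (Fin N)) 1) ^
      (1 / (N : ℝ)) * distribFn u t ^ (1 - 1 / (N : ℝ)) ≤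
      ∫⁻ x in {x | |u x| ∈ F}, ‖fderiv ℝ u x‖ₑ := by
  let ε : ℕ → ℝ := fun n => 1 / ((n : ℝ) + 1)
  have hε0 : ∀ n, 0 < ε n := fun n => by positivity
  have hε1 : ∀ n, ε n ≤ 1 := fun n => by
    rw [div_le_one (by positivity)]
    linarith [Nat.cast_nonneg (α := ℝ) n]
  have hε : Tendsto ε atTop (𝓝 0) := tendsto_one_div_add_atTop_nhds_zero_nat
  obtain ⟨C, hC⟩ := hu.lipschitzWith_of_hasCompactSupport hc one_ne_zero
  let K := Metric.cthickening 1 (tsupport u)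
  have hK : IsCompact K := hc.isCompact.cthickening
  have hFm : MeasurableSet {x | |u x| ∈ F} := hu.continuous.abs.measurable hF.measurableSet
  have hn0 : ∀ n, ENNReal.ofReal (ε n) ≠ 0 := fun n => by simpa using hε0 n
  have hbound : ∀ n x, (ENNReal.ofReal (ε n))⁻¹ * levelOscillation u F (ε n) x ≤
      K.indicator (fun _ => (C : ℝ≥0∞)) x := by
    intro n x
    by_cases hx : x ∈ K
    · rw [indicator_of_mem hx]
      calc (ENNReal.ofReal (ε n))⁻¹ * levelOscillation u F (ε n) x
          ≤ (ENNReal.ofReal (ε n))⁻¹ * ENNReal.ofReal (C * ε n) := by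
            gcongr
            refine levelOscillation_le fun y hy => ?_
            have h1 := hC.dist_le_mul y x
            rw [dist_comm y x, Real.dist_eq] at h1
            have h2 : |u y| - |u x| ≤ |u y - u x| := abs_sub_abs_le_abs_sub _ _
            have h3 : C * dist x y ≤ C * ε n := by gcongr
            linarith
        _ = C := by
            rw [ENNReal.ofReal_mul (by positivity), mul_comm, mul_assoc,
              ENNReal.mul_inv_cancel (hn0 n) ofReal_ne_top, mul_one, ofReal_coe_nnreal]
    · rw [indicator_of_notMem hx]
      have : {t | t ∈ F ∧ |u x| ≤ t ∧ x ∈ Metric.thickening (ε n) {y | t < |u y|}} = ∅ := by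
        refine eq_empty_of_forall_notMem fun t ⟨ht, hxt, hxA⟩ => hx ?_
        obtain ⟨y, hy, hxy⟩ := Metric.mem_thickening_iff.1 hxA
        have hy' : t < |u y| := hy
        have ht' : 0 < t := hF0 ht
        refine Metric.mem_cthickening_of_dist_le x y _ _ (subset_tsupport u ?_)
          (hxy.le.trans (hε1 n))
        exact abs_pos.1 (ht'.trans hy')
      simp [levelOscillation, this]
  have h1 := limsup_lintegral_le (μ := volume) (K.indicator fun _ => (C : ℝ≥0∞))
    (fun n => (measurable_levelOscillation hu.continuous hF.measurableSet (ε n)).const_mul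
      (ENNReal.ofReal (ε n))⁻¹) (fun n => ae_of_all _ (hbound n)) (by
        rw [lintegral_indicator hK.measurableSet, setLIntegral_const]
        exact mul_ne_top coe_ne_top hK.measure_lt_top.ne)
  rw [← lintegral_indicator hFm]
  refine le_trans ?_ (h1.trans (lintegral_mono fun x => limsup_levelOscillation_le hu hF hε0 hε x))
  refine le_limsup_of_frequently_le (Frequently.of_forall fun n => ?_)
  rw [lintegral_const_mul _ (measurable_levelOscillation hu.continuous hF.measurableSet _),
    mul_comm (ENNReal.ofReal (ε n))⁻¹, ← div_eq_mul_inv,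
    ENNReal.le_div_iff_mul_le (Or.inl (hn0 n)) (Or.inl ofReal_ne_top), mul_comm]
  exact lintegral_levelOscillation_ge hN hu.continuous hc hF.measurableSet hF0 (hε0 n)

theorem antitone_distribFn (f : EuclideanSpace ℝ (Fin N) → ℝ) : Antitone (distribFn f) :=
  fun _ _ hab => measure_mono fun _ hx => lt_of_le_of_lt hab hx

theorem distribFn_le_volume_tsupport {t : ℝ} (ht : 0 ≤ t) :
    distribFn u t ≤ volume (tsupport u) :=
  measure_mono fun _ hx => subset_tsupport u (abs_pos.1 (lt_of_le_of_lt ht hx))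

/-- The coarea formula combined with the isoperimetric inequality. -/
theorem lintegral_mul_isoperimetric_le (hN : 2 ≤ N) (hu : ContDiff ℝ 1 u)
    (hc : HasCompactSupport u) {g : ℝ → ℝ≥0∞} (hg : Measurable g) :
    ∫⁻ t in Ioi 0, g t * (N * volume (Metric.ball (0 : EuclideanSpace ℝ (Fin N)) 1) ^
      (1 / (N : ℝ)) * distribFn u t ^ (1 - 1 / (N : ℝ))) ≤
      ∫⁻ x in {x | 0 < |u x|}, g |u x| * ‖fderiv ℝ u x‖ₑ := by
  set Λ : ℝ → ℝ≥0∞ := fun t => N * volume (Metric.ball (0 : EuclideanSpace ℝ (Fin N)) 1) ^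
      (1 / (N : ℝ)) * distribFn u t ^ (1 - 1 / (N : ℝ)) with hΛ
  have hN0 : (N : ℝ) ≠ 0 := by positivity
  have hN1 : 0 < 1 - 1 / (N : ℝ) := by
    rw [sub_pos, div_lt_one (by positivity)]
    exact_mod_cast hN
  have hΛm : Measurable Λ := ((antitone_distribFn u).measurable.pow_const _).const_mul _
  have huabs : Measurable fun x => |u x| := hu.continuous.abs.measurable
  have hDm : Measurable fun x => ‖fderiv ℝ u x‖ₑ :=
    (hu.continuous_fderiv one_ne_zero).enorm.measurable
  set ρ := (volume.restrict (Ioi (0 : ℝ))).withDensity Λ with hρ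
  set ν := ((volume.restrict {x | 0 < |u x|}).withDensity fun x => ‖fderiv ℝ u x‖ₑ).map
    (fun x => |u x|) with hν
  have hpos : MeasurableSet {x | 0 < |u x|} := measurableSet_lt measurable_const huabs
  have hρfin : IsFiniteMeasure ρ := by
    obtain ⟨M, hM⟩ := hc.exists_bound_of_continuous hu.continuous
    refine isFiniteMeasure_withDensity ?_
    have hΛle : ∀ t, 0 < t → Λ t ≤ (Iic M).indicator
        (fun _ => N * volume (Metric.ball (0 : EuclideanSpace ℝ (Fin N)) 1) ^
      (1 / (N : ℝ)) * volume (tsupport u) ^ (1 - 1 / (N : ℝ))) t := by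
      intro t ht
      by_cases htM : t ∈ Iic M
      · rw [indicator_of_mem htM]
        simp only [hΛ]
        gcongr
        exact distribFn_le_volume_tsupport ht.le
      · have : distribFn u t = 0 := by
          have : {x | t < |u x|} = ∅ := eq_empty_of_forall_notMem fun x hx =>
            htM (le_of_lt (lt_of_lt_of_le hx (hM x)))
          simp [distribFn, this]
        simp only [hΛ, this, ENNReal.zero_rpow_of_pos hN1]
        simp
    refine ((setLIntegral_mono' measurableSet_Ioi hΛle).trans_lt ?_).ne
    rw [lintegral_indicator measurableSet_Iic, lintegral_const]
    refine mul_lt_top (mul_lt_top (mul_lt_top (natCast_lt_top N)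
      (rpow_lt_top_of_nonneg (by positivity) measure_ball_lt_top.ne))
      (rpow_lt_top_of_nonneg hN1.le hc.measure_lt_top.ne)) ?_
    rw [Measure.restrict_restrict measurableSet_Iic, Measure.restrict_apply_univ,
      Iic_inter_Ioi]
    exact measure_Ioc_lt_top
  have hle : ρ ≤ ν := by
    refine Measure.le_iff.2 fun B hB => ?_
    have hρB : ρ B = ρ (B ∩ Ioi 0) := by
      rw [hρ, withDensity_apply _ hB, withDensity_apply _ (hB.inter measurableSet_Ioi),
        Measure.restrict_restrict hB, Measure.restrict_restrict (hB.inter measurableSet_Ioi),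
        inter_assoc, inter_self]
    rw [hρB]
    refine le_of_forall_lt fun r hr => ?_
    obtain ⟨F, hFB, hF, hrF⟩ := (hB.inter measurableSet_Ioi).exists_lt_isClosed_of_ne_top
      (measure_ne_top ρ _) hr
    have hF0 : F ⊆ Ioi 0 := hFB.trans inter_subset_right
    have hpre : MeasurableSet ((fun x => |u x|) ⁻¹' F) := huabs hF.measurableSet
    refine hrF.trans_le (le_trans ?_ (measure_mono (hFB.trans inter_subset_left)))
    rw [hρ, hν, withDensity_apply _ hF.measurableSet, Measure.map_apply huabs hF.measurableSet,
      withDensity_apply _ hpre, Measure.restrict_restrict hF.measurableSet,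
      Measure.restrict_restrict hpre, inter_eq_left.2 hF0,
      inter_eq_left.2 (show (fun x => |u x|) ⁻¹' F ⊆ {x | 0 < |u x|} from fun x hx => hF0 hx)]
    exact lintegral_isoperimetric_le_of_isClosed hN hu hc hF hF0
  have h2 := lintegral_mono' hle (le_refl g)
  rw [hρ, hν, lintegral_map hg huabs, lintegral_withDensity_eq_lintegral_mul _ hΛm hg] at h2
  have h3 := lintegral_withDensity_eq_lintegral_mul (volume.restrict {x | 0 < |u x|}) hDm
    (hg.comp huabs)
  simp only [Function.comp_apply] at h3
  rw [h3] at h2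
  simpa only [Pi.mul_apply, Function.comp_apply, mul_comm (Λ _), mul_comm ‖_‖ₑ] using h2

end Coarea

end Pointwise

section Rearrangement

theorem lintegral_Ioo_rpow {c : ℝ} {a b : ℝ} (ha : 0 ≤ a) (hab : a ≤ b) (hc : -1 < c ∨ 0 < a)
    (hc1 : c ≠ -1) :
    ∫⁻ r in Ioo a b, ENNReal.ofReal (r ^ c) =
      ENNReal.ofReal ((b ^ (c + 1) - a ^ (c + 1)) / (c + 1)) := by
  have h0 : -1 < c ∨ c ≠ -1 ∧ (0 : ℝ) ∉ uIcc a b := by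
    refine hc.imp_right fun ha => ⟨hc1, fun h => ?_⟩
    rw [uIcc_of_le hab] at h
    exact absurd h.1 (not_le.2 ha)
  have hint : IntervalIntegrable (fun r : ℝ => r ^ c) volume a b := by
    rcases h0 with h0 | h0
    · exact intervalIntegral.intervalIntegrable_rpow' h0
    · exact intervalIntegral.intervalIntegrable_rpow (Or.inr h0.2)
  rw [← integral_rpow h0, intervalIntegral.integral_of_le hab, ofReal_integral_eq_lintegral_ofReal
    ((intervalIntegrable_iff_integrableOn_Ioc_of_le hab).1 hint), restrict_Ioo_eq_restrict_Ioc]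
  rw [Filter.EventuallyLE, ae_restrict_iff' measurableSet_Ioc]
  exact ae_of_all _ fun r hr => Real.rpow_nonneg (ha.trans hr.1.le) _

theorem ae_ne_zero_of_measure_lt_le {α : Type*} [MeasurableSpace α] {μ : Measure α}
    {s : α → ℝ≥0∞} (hμ : ∀ r, μ {x | s x < r} ≤ r) : ∀ᵐ x ∂μ, s x ≠ 0 := by
  rw [ae_iff]
  simp only [ne_eq, not_not]
  refine le_antisymm (ENNReal.le_of_forall_pos_le_add fun η hη _ => ?_) zero_le
  rw [zero_add]
  refine le_trans (measure_mono fun x hx => ?_) (hμ η)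
  have hx : s x = 0 := hx
  simpa [hx] using hη

/-- If `μ {s < r} ≤ r` for every `r`, the integral of the decreasing weight `s ^ (γ - 1)` over a set
is at most that of `r ^ (γ - 1)` over an initial interval of the same measure. -/
theorem setLIntegral_rpow_le {α : Type*} [MeasurableSpace α] {μ : Measure α} [SFinite μ]
    {s : α → ℝ≥0∞} (hs : Measurable s) (hμ : ∀ r, μ {x | s x < r} ≤ r) {γ : ℝ} (hγ0 : 0 < γ)
    (hγ1 : γ ≤ 1) (E : Set α) :
    ∫⁻ x in E, s x ^ (γ - 1) ∂μ ≤ ENNReal.ofReal (1 / γ) * μ E ^ γ := by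
  rcases hγ1.eq_or_lt with rfl | hγ1
  · simp
  rcases eq_or_ne (μ E) ⊤ with hEt | hEt
  · rw [hEt, ENNReal.top_rpow_of_pos hγ0, ENNReal.mul_top (by simpa using hγ0)]
    exact le_top
  rcases eq_or_ne (μ E) 0 with hE0 | hE0
  · rw [Measure.restrict_eq_zero.2 hE0]
    simp
  set m := (μ E).toReal with hm
  have hm0 : 0 < m := toReal_pos hE0 hEt
  have hmE : μ E = ENNReal.ofReal m := (ofReal_toReal hEt).symm
  have hs0 : ∀ᵐ x ∂μ, s x ≠ 0 := ae_ne_zero_of_measure_lt_le hμ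
  set k : ℝ → ℝ≥0∞ := fun r => ENNReal.ofReal ((1 - γ) * r ^ (γ - 2)) with hk
  have hkm : Measurable k := by fun_prop
  have hpt : ∀ x, s x ≠ 0 → s x ^ (γ - 1) ≤ ENNReal.ofReal (m ^ (γ - 1)) +
      ∫⁻ r in Ioo 0 m, {z : α × ℝ | s z.1 < ENNReal.ofReal z.2}.indicator (fun z => k z.2)
        (x, r) := by
    intro x hx
    rcases le_or_gt (ENNReal.ofReal m) (s x) with h | h
    · refine le_add_right ?_
      rw [← ENNReal.ofReal_rpow_of_pos hm0, ← neg_sub 1 γ, ENNReal.rpow_neg, ENNReal.rpow_neg]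
      exact ENNReal.inv_le_inv.2 (ENNReal.rpow_le_rpow h (by linarith))
    · have hxt : s x ≠ ⊤ := (h.trans ofReal_lt_top).ne
      set σ := (s x).toReal with hσ
      have hσ0 : 0 < σ := toReal_pos hx hxt
      have hσx : s x = ENNReal.ofReal σ := (ofReal_toReal hxt).symm
      have hσm : σ < m := by
        rw [hσx] at h
        exact (ENNReal.ofReal_lt_ofReal_iff hm0).1 h
      have h1 : ∫⁻ r in Ioo σ m, k r = ENNReal.ofReal (σ ^ (γ - 1) - m ^ (γ - 1)) := by
        simp only [hk, ENNReal.ofReal_mul (sub_nonneg.2 hγ1.le)]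
        rw [lintegral_const_mul _ (by fun_prop),
          lintegral_Ioo_rpow hσ0.le hσm.le (Or.inr hσ0) (by linarith),
          ← ENNReal.ofReal_mul (by linarith)]
        congr 1
        have : γ - 2 + 1 = γ - 1 := by ring
        rw [this]
        have : γ - 1 ≠ 0 := by linarith
        field_simp
        ring
      have h2 : ∫⁻ r in Ioo σ m, k r ≤ ∫⁻ r in Ioo 0 m,
          {z : α × ℝ | s z.1 < ENNReal.ofReal z.2}.indicator (fun z => k z.2) (x, r) := by
        refine le_trans (le_of_eq ?_) (lintegral_mono_set (Ioo_subset_Ioo_left hσ0.le))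
        refine setLIntegral_congr_fun measurableSet_Ioo fun r hr => ?_
        have : (x, r) ∈ {z : α × ℝ | s z.1 < ENNReal.ofReal z.2} := by
          simp only [mem_ofPred_eq, hσx]
          exact (ENNReal.ofReal_lt_ofReal_iff (hσ0.trans hr.1)).2 hr.1
        simp only [indicator_of_mem this]
      have h3 : m ^ (γ - 1) ≤ σ ^ (γ - 1) :=
        Real.rpow_le_rpow_of_nonpos hσ0 hσm.le (by linarith)
      calc s x ^ (γ - 1) = ENNReal.ofReal (m ^ (γ - 1)) + ∫⁻ r in Ioo σ m, k r := by
            rw [h1, ← ENNReal.ofReal_add (by positivity) (by linarith), hσx,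
              ENNReal.ofReal_rpow_of_pos hσ0]
            congr 1
            ring
        _ ≤ _ := by gcongr
  have hSm : MeasurableSet {z : α × ℝ | s z.1 < ENNReal.ofReal z.2} :=
    measurableSet_lt (hs.comp measurable_fst) (ENNReal.measurable_ofReal.comp measurable_snd)
  have hIm : Measurable ({z : α × ℝ | s z.1 < ENNReal.ofReal z.2}.indicator (fun z => k z.2)) :=
    (hkm.comp measurable_snd).indicator hSm
  calc ∫⁻ x in E, s x ^ (γ - 1) ∂μ
      ≤ ∫⁻ x in E, (ENNReal.ofReal (m ^ (γ - 1)) + ∫⁻ r in Ioo 0 m,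
          {z : α × ℝ | s z.1 < ENNReal.ofReal z.2}.indicator (fun z => k z.2) (x, r)) ∂μ :=
        lintegral_mono_ae ((ae_restrict_of_ae hs0).mono fun x hx => hpt x hx)
    _ = ENNReal.ofReal (m ^ (γ - 1)) * μ E + ∫⁻ r in Ioo 0 m, ∫⁻ x in E,
          {z : α × ℝ | s z.1 < ENNReal.ofReal z.2}.indicator (fun z => k z.2) (x, r) ∂μ := by
        rw [lintegral_add_left measurable_const, setLIntegral_const]
        congr 1
        exact lintegral_lintegral_swap hIm.aemeasurable
    _ ≤ ENNReal.ofReal (m ^ (γ - 1)) * μ E +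
          ∫⁻ r in Ioo 0 m, ENNReal.ofReal ((1 - γ) * r ^ (γ - 1)) := by
        refine add_le_add le_rfl (setLIntegral_mono' measurableSet_Ioo fun r hr => ?_)
        have h1 : ∀ x, {z : α × ℝ | s z.1 < ENNReal.ofReal z.2}.indicator (fun z => k z.2) (x, r) =
            {x | s x < ENNReal.ofReal r}.indicator (fun _ => k r) x := fun x => rfl
        simp only [h1]
        have hlt : MeasurableSet {x | s x < ENNReal.ofReal r} :=
          measurableSet_lt hs measurable_const
        rw [lintegral_indicator hlt, setLIntegral_const]
        calc k r * μ.restrict E {x | s x < ENNReal.ofReal r}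
            ≤ k r * ENNReal.ofReal r := by
              gcongr
              exact (Measure.restrict_apply_le _ _).trans (hμ _)
          _ = ENNReal.ofReal ((1 - γ) * r ^ (γ - 1)) := by
              simp only [hk]
              rw [← ENNReal.ofReal_mul
                (mul_nonneg (by linarith) (Real.rpow_nonneg hr.1.le _)), mul_assoc]
              congr 2
              rw [← Real.rpow_add_one hr.1.ne']
              congr 1
              ring
    _ = ENNReal.ofReal (1 / γ) * μ E ^ γ := by
        simp only [ENNReal.ofReal_mul (sub_nonneg.2 hγ1.le)]
        rw [lintegral_const_mul _ (by fun_prop),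
          lintegral_Ioo_rpow le_rfl hm0.le (Or.inl (by linarith)) (by linarith), hmE,
          ENNReal.ofReal_rpow_of_pos hm0, sub_add_cancel, Real.zero_rpow hγ0.ne',
          ← ENNReal.ofReal_mul (by positivity), ← ENNReal.ofReal_mul (by linarith),
          ← ENNReal.ofReal_mul (by positivity), ← Real.rpow_add_one hm0.ne', sub_add_cancel,
          ← ENNReal.ofReal_add (by positivity)
            (mul_nonneg (by linarith) (by rw [sub_zero]; positivity))]
        congr 1
        field_simp
        ring

variable {N : ℕ}

/-- A weighted integral of `|f| ^ q`, with a decreasing weight, is at most the one of the decreasing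
rearrangement of `f`. -/
theorem lintegral_rpow_mul_rpow_le {f : EuclideanSpace ℝ (Fin N) → ℝ} (hf : Measurable f)
    {s : EuclideanSpace ℝ (Fin N) → ℝ≥0∞} (hs : Measurable s)
    (hμ : ∀ r, volume {x | s x < r} ≤ r) {q r : ℝ} (hq : 0 < q) (hqr : q ≤ r) :
    ∫⁻ x, ENNReal.ofReal (|f x| ^ q) * s x ^ (q / r - 1) ≤ ENNReal.ofReal r *
      ∫⁻ k in Ioi (0 : ℝ), distribFn f k ^ (q / r) * ENNReal.ofReal (k ^ (q - 1)) := by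
  have hr : 0 < r := hq.trans_le hqr
  have hfm : Measurable fun x => |f x| := by
    simpa only [Real.norm_eq_abs] using hf.norm
  have hsm : Measurable fun x => s x ^ (q / r - 1) := hs.pow_const _
  have h1 := lintegral_rpow_eq_lintegral_meas_lt_mul
    (volume.withDensity fun x => s x ^ (q / r - 1)) (ae_of_all _ fun x => abs_nonneg (f x))
    hfm.aemeasurable hq
  rw [lintegral_withDensity_eq_lintegral_mul _ hsm (by fun_prop)] at h1
  simp only [Pi.mul_apply] at h1
  simp only [mul_comm (ENNReal.ofReal (|f _| ^ q))]
  rw [h1]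
  calc ENNReal.ofReal q * ∫⁻ t in Ioi 0, (volume.withDensity fun x => s x ^ (q / r - 1))
        {a | t < |f a|} * ENNReal.ofReal (t ^ (q - 1))
      ≤ ENNReal.ofReal q * ∫⁻ t in Ioi 0, ENNReal.ofReal (1 / (q / r)) *
          (distribFn f t ^ (q / r) * ENNReal.ofReal (t ^ (q - 1))) := by
        gcongr ENNReal.ofReal q * ?_
        refine lintegral_mono fun t => ?_
        rw [withDensity_apply _ (measurableSet_lt measurable_const hfm), ← mul_assoc]
        gcongr ?_ * _
        exact setLIntegral_rpow_le hs hμ (by positivity) (by rwa [div_le_one hr]) _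
    _ = _ := by
        rw [lintegral_const_mul' _ _ ofReal_ne_top, ← mul_assoc, ← ENNReal.ofReal_mul hq.le]
        congr 2
        field_simp

/-- The rank of a point with respect to the values of `f` has a sublinear distribution. -/
theorem volume_rank_lt_le {f : EuclideanSpace ℝ (Fin N) → ℝ} (r : ℝ≥0∞) :
    volume {x | volume {y | f x ≤ f y} < r} ≤ r := by
  rcases eq_or_ne r ⊤ with rfl | hr
  · exact le_top
  by_cases hne : {x | volume {y | f x ≤ f y} < r}.Nonempty
  swap
  · simp [not_nonempty_iff_eq_empty.1 hne]
  set T := {t : ℝ | volume {y | t ≤ f y} < r} with hT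
  have hTup : IsUpperSet T := fun a b hab ha =>
    lt_of_le_of_lt (measure_mono fun y hy => hab.trans hy) ha
  have : T.OrdConnected := hTup.ordConnected
  have : Nonempty T := hne.elim fun x hx => ⟨⟨f x, hx⟩⟩
  obtain ⟨c, hc, hcT⟩ := Filter.exists_seq_antitone_tendsto_atTop_atBot T
  have hmono : Monotone fun n => {y | (c n : ℝ) ≤ f y} := fun m n hmn y hy =>
    le_trans (show (c n : ℝ) ≤ c m from hc hmn) hy
  calc volume {x | volume {y | f x ≤ f y} < r} ≤ volume (⋃ n, {y | (c n : ℝ) ≤ f y}) := by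
        refine measure_mono fun x hx => ?_
        obtain ⟨n, hn⟩ := (hcT.eventually (Filter.eventually_le_atBot (⟨f x, hx⟩ : T))).exists
        exact mem_iUnion.2 ⟨n, hn⟩
    _ = ⨆ n, volume {y | (c n : ℝ) ≤ f y} := hmono.measure_iUnion
    _ ≤ r := iSup_le fun n => (c n).2.le

end Rearrangement

/-- The Lorentz integral of a bounded function with compact support is finite. -/
theorem lintegral_distribFn_lt_top {N : ℕ} {u : EuclideanSpace ℝ (Fin N) → ℝ} (hu : Continuous u)
    (hc : HasCompactSupport u) {a q : ℝ} (ha : 0 < a) (hq : 1 ≤ q) :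
    ∫⁻ k in Ioi (0 : ℝ), distribFn u k ^ a * ENNReal.ofReal (k ^ (q - 1)) < ⊤ := by
  obtain ⟨M, hM⟩ := hc.exists_bound_of_continuous hu
  have hle : ∀ t ∈ Ioi (0 : ℝ), distribFn u t ^ a * ENNReal.ofReal (t ^ (q - 1)) ≤
      (Iic M).indicator (fun _ => volume (tsupport u) ^ a * ENNReal.ofReal (M ^ (q - 1))) t := by
    intro t (ht : 0 < t)
    by_cases htM : t ∈ Iic M
    · rw [indicator_of_mem htM]
      have htM : t ≤ M := htM
      gcongr
      · exact distribFn_le_volume_tsupport ht.le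
    · have : distribFn u t = 0 := by
        have : {x | t < |u x|} = ∅ := eq_empty_of_forall_notMem fun x hx =>
          htM (le_of_lt (lt_of_lt_of_le hx (hM x)))
        simp [distribFn, this]
      rw [this, ENNReal.zero_rpow_of_pos ha]
      simp
  refine (setLIntegral_mono' measurableSet_Ioi hle).trans_lt ?_
  rw [lintegral_indicator measurableSet_Iic, lintegral_const,
    Measure.restrict_restrict measurableSet_Iic, Measure.restrict_apply_univ, Iic_inter_Ioi]
  exact mul_lt_top (mul_lt_top (rpow_lt_top_of_nonneg ha.le hc.measure_lt_top.ne) ofReal_lt_top)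
    measure_Ioc_lt_top

/-- **Sobolev embedding theorem in Lorentz spaces.** For `N ≥ 2`, `1 < p < N`,
`1 ≤ q ≤ p`, every smooth compactly supported `u : ℝ^N → ℝ` satisfies
`‖u‖_{p*,q} ≤ S_{N,p} ‖|∇u|‖_{p,q}`, where `p* = Np/(N−p)` and
`S_{N,p} = ω_N^{−1/N} p/(N−p)`, with `ω_N` the measure of the unit ball. -/
theorem stmt_7 (N : ℕ) (hN : 2 ≤ N)
    (p q : ℝ) (hp₁ : 1 < p) (hp₂ : p < N) (hq₁ : 1 ≤ q) (hq₂ : q ≤ p)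
    (u : EuclideanSpace ℝ (Fin N) → ℝ)
    (hu_smooth : ContDiff ℝ (⊤ : ℕ∞) u) (hu_supp : HasCompactSupport u) :
    lorentzNorm ((N : ℝ) * p / ((N : ℝ) - p)) q u ≤
      ENNReal.ofReal
        ((volume (Metric.ball (0 : EuclideanSpace ℝ (Fin N)) 1)).toReal ^ (-(1 / (N : ℝ))) *
          (p / ((N : ℝ) - p))) *
        lorentzNorm p q (fun x => ‖fderiv ℝ u x‖) := by
  have hN0 : (0 : ℝ) < N := by positivity
  have hNp : 0 < (N : ℝ) - p := by linarith
  have hp0 : 0 < p := by linarith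
  have hq0 : 0 < q := by linarith
  set P : ℝ := (N : ℝ) * p / ((N : ℝ) - p) with hP
  have hP0 : 0 < P := by positivity
  have hqP : q / P = q / p - q / N := by
    rw [hP]
    field_simp
  have hqP' : q ≤ P := by
    rw [hP, le_div_iff₀ hNp]
    nlinarith [mul_pos hq0 hp0]
  have hu1 : ContDiff ℝ 1 u := hu_smooth.of_le (by exact_mod_cast le_top)
  have huc := hu1.continuous
  have huabs : Measurable fun x => |u x| := huc.abs.measurable
  set R : ℝ → ℝ≥0∞ := fun t => volume {y | t ≤ |u y|} with hR
  have hRm : Measurable R :=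
    Antitone.measurable fun a b hab => measure_mono fun x hx => le_trans hab hx
  set s : EuclideanSpace ℝ (Fin N) → ℝ≥0∞ := fun x => R |u x| with hs
  have hsm : Measurable s := hRm.comp huabs
  have hsμ : ∀ r, volume {x | s x < r} ≤ r := fun r => volume_rank_lt_le (f := fun x => |u x|) r
  have hs0 : ∀ᵐ x, s x ≠ 0 := ae_ne_zero_of_measure_lt_le hsμ
  have hRt : ∀ t, 0 < t → R t ≠ ⊤ := fun t ht =>
    ((measure_mono fun x hx => subset_tsupport u (abs_pos.1 (lt_of_lt_of_le ht hx))).trans_lt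
      hu_supp.measure_lt_top).ne
  set J : ℝ≥0∞ := ∫⁻ k in Ioi (0 : ℝ), distribFn u k ^ (q / P) * ENNReal.ofReal (k ^ (q - 1))
    with hJ
  set I : ℝ≥0∞ := ENNReal.ofReal P * J with hI
  set D : ℝ≥0∞ := ENNReal.ofReal p * ∫⁻ k in Ioi (0 : ℝ),
    distribFn (fun x => ‖fderiv ℝ u x‖) k ^ (q / p) * ENNReal.ofReal (k ^ (q - 1)) with hD
  set κ : ℝ≥0∞ := N * volume (Metric.ball (0 : EuclideanSpace ℝ (Fin N)) 1) ^ (1 / (N : ℝ)) with hκ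
  set α : ℝ := (q / p - 1) - (q - 1) / N with hα
  have hgrad : Measurable fun x => ‖fderiv ℝ u x‖ :=
    (hu1.continuous_fderiv one_ne_zero).norm.measurable
  have hA := lintegral_rpow_mul_rpow_le hgrad hsm hsμ hq0 hq₂
  have hB := lintegral_rpow_mul_rpow_le huc.measurable hsm hsμ hq0 hqP'
  simp only [abs_norm] at hA
  have hJt : J < ⊤ := lintegral_distribFn_lt_top huc hu_supp (by positivity) hq₁
  have hC := lintegral_mul_isoperimetric_le hN hu1 hu_supp
    (g := fun t => ENNReal.ofReal (t ^ (q - 1)) * R t ^ α)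
    ((by fun_prop : Measurable fun t : ℝ => ENNReal.ofReal (t ^ (q - 1))).mul (hRm.pow_const α))
  have hleft : κ * J ≤ ∫⁻ t in Ioi 0, ENNReal.ofReal (t ^ (q - 1)) * R t ^ α *
      (κ * distribFn u t ^ (1 - 1 / (N : ℝ))) := by
    have hm : Measurable fun k : ℝ => distribFn u k ^ (q / P) * ENNReal.ofReal (k ^ (q - 1)) :=
      ((antitone_distribFn u).measurable.pow_const _).mul (by fun_prop)
    rw [hJ, ← lintegral_const_mul _ hm]
    refine lintegral_mono_ae ?_
    filter_upwards [meas_le_ae_eq_meas_lt volume (volume.restrict (Ioi (0 : ℝ))) fun x => |u x|,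
      ae_restrict_mem measurableSet_Ioi] with t ht ht0
    have ht : R t = distribFn u t := ht
    rw [← ht]
    rcases eq_or_ne (R t) 0 with h0 | h0
    · rw [h0, ENNReal.zero_rpow_of_pos (by positivity)]
      simp
    · have : q / P = α + (1 - 1 / (N : ℝ)) := by
        rw [hqP, hα]
        ring
      rw [this, ENNReal.rpow_add _ _ h0 (hRt t ht0)]
      exact le_of_eq (by ring)
  have hright : ∫⁻ x in {x | 0 < |u x|}, ENNReal.ofReal (|u x| ^ (q - 1)) * R |u x| ^ α *
      ‖fderiv ℝ u x‖ₑ ≤ D ^ (1 / q) * I ^ (1 - 1 / q) := by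
    have hq1 : 0 ≤ 1 - 1 / q := by
      rw [sub_nonneg, div_le_one hq0]
      exact hq₁
    calc ∫⁻ x in {x | 0 < |u x|}, ENNReal.ofReal (|u x| ^ (q - 1)) * R |u x| ^ α * ‖fderiv ℝ u x‖ₑ
        = ∫⁻ x in {x | 0 < |u x|},
            (ENNReal.ofReal (‖fderiv ℝ u x‖ ^ q) * s x ^ (q / p - 1)) ^ (1 / q) * (ENNReal.ofReal (|u x| ^ q) * s x ^ (q / P - 1)) ^ (1 - 1 / q) := by
          refine lintegral_congr_ae ?_
          filter_upwards [ae_restrict_of_ae hs0,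
            ae_restrict_mem (measurableSet_lt measurable_const huabs)] with x hx0 hux
          have hux : 0 < |u x| := hux
          have hxt : s x ≠ ⊤ := hRt _ hux
          rw [ENNReal.mul_rpow_of_nonneg _ _ (by positivity), ENNReal.mul_rpow_of_nonneg _ _ hq1,
            ← ENNReal.rpow_mul, ← ENNReal.rpow_mul,
            ENNReal.ofReal_rpow_of_nonneg (by positivity) (by positivity),
            ENNReal.ofReal_rpow_of_nonneg (by positivity) hq1,
            ← Real.rpow_mul (norm_nonneg _), ← Real.rpow_mul (abs_nonneg _),
            mul_one_div_cancel hq0.ne', Real.rpow_one, ofReal_norm]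
          have e1 : q * (1 - 1 / q) = q - 1 := by field_simp
          have e2 : α = (q / p - 1) * (1 / q) + (q / P - 1) * (1 - 1 / q) := by
            rw [hα, hqP]
            field_simp
            ring
          rw [e1, e2]
          change _ * s x ^ _ * _ = _
          rw [ENNReal.rpow_add _ _ hx0 hxt]
          ring
      _ ≤ (∫⁻ x in {x | 0 < |u x|}, ENNReal.ofReal (‖fderiv ℝ u x‖ ^ q) * s x ^ (q / p - 1)) ^
              (1 / q) * (∫⁻ x in {x | 0 < |u x|}, ENNReal.ofReal (|u x| ^ q) * s x ^ (q / P - 1)) ^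
              (1 - 1 / q) :=
          ENNReal.lintegral_mul_norm_pow_le
            ((hgrad.pow_const q).ennreal_ofReal.mul (hsm.pow_const _)).aemeasurable
            ((huabs.pow_const q).ennreal_ofReal.mul (hsm.pow_const _)).aemeasurable
            (by positivity) hq1 (by ring)
      _ ≤ D ^ (1 / q) * I ^ (1 - 1 / q) :=
          mul_le_mul' (rpow_le_rpow ((setLIntegral_le_lintegral _ _).trans hA) (by positivity))
            (rpow_le_rpow ((setLIntegral_le_lintegral _ _).trans hB) hq1)
  have hmain : κ * J ≤ D ^ (1 / q) * I ^ (1 - 1 / q) := hleft.trans (hC.trans hright)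
  change I ^ (1 / q) ≤ _ * D ^ (1 / q)
  have hIt : I ≠ ⊤ := (mul_lt_top ofReal_lt_top hJt).ne
  rcases eq_or_ne I 0 with hI0 | hI0
  · rw [hI0, ENNReal.zero_rpow_of_pos (by positivity)]
    exact zero_le
  have : Nonempty (Fin N) := ⟨⟨0, by lia⟩⟩
  set ω := (volume (Metric.ball (0 : EuclideanSpace ℝ (Fin N)) 1)).toReal with hω
  have hωt : volume (Metric.ball (0 : EuclideanSpace ℝ (Fin N)) 1) ≠ ⊤ := measure_ball_lt_top.ne
  have hω0 : 0 < ω := toReal_pos (Metric.measure_ball_pos _ _ one_pos).ne' hωt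
  have hκω : κ = ENNReal.ofReal (N * ω ^ (1 / (N : ℝ))) := by
    rw [ENNReal.ofReal_mul (by positivity), ENNReal.ofReal_natCast,
      ← ENNReal.ofReal_rpow_of_pos hω0, hω, ofReal_toReal hωt]
  set S : ℝ := ω ^ (-(1 / (N : ℝ))) * (p / ((N : ℝ) - p)) with hS
  have hS0 : 0 ≤ S := by positivity
  have hSκ : ENNReal.ofReal S * κ = ENNReal.ofReal P := by
    rw [hκω, ← ENNReal.ofReal_mul hS0]
    congr 1
    rw [hS, hP, Real.rpow_neg hω0.le]
    field_simp
  have hsplit : I = I ^ (1 / q) * I ^ (1 - 1 / q) := by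
    rw [← ENNReal.rpow_add _ _ hI0 hIt, add_sub_cancel, ENNReal.rpow_one]
  have hfin : I ^ (1 / q) * I ^ (1 - 1 / q) ≤
      (ENNReal.ofReal S * D ^ (1 / q)) * I ^ (1 - 1 / q) := by
    have hIκ : I = ENNReal.ofReal S * (κ * J) := by rw [← mul_assoc, hSκ]
    calc I ^ (1 / q) * I ^ (1 - 1 / q) = ENNReal.ofReal S * (κ * J) := hsplit.symm.trans hIκ
      _ ≤ ENNReal.ofReal S * (D ^ (1 / q) * I ^ (1 - 1 / q)) := by gcongr
      _ = _ := (mul_assoc _ _ _).symm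
  refine (ENNReal.mul_le_mul_iff_left ?_ ?_).1 hfin
  · exact (ENNReal.rpow_pos (pos_iff_ne_zero.2 hI0) hIt).ne'
  · exact (ENNReal.rpow_ne_top_of_ne_zero hI0 hIt)
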